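/- Let N ≥ 4 and fix an integer N' with 2 ≤ N' ≤ N−2. Let H be an H-matrix satisfying the H-invariance conditions P(N−1,m;H) = (1/N)·C(N,m+1) for m = 1,…,N−1, satisfying λ*_{k,j}(H) = 0 for all j = 1,…,N'−1 and k = j+2,…,N, and satisfying λ*_{k,j}(H) = 0 for all j = N',…,N−2 and k = j+1,…,N−1. Then for all admissible j and k = 1,…,N−j: Q(N−1,k,j;H) = (j/N)·C(N−j−1,k−1) if 1 ≤ j ≤ N'−1; Q(N−1,k,N';H) = (N'(N−N'+1)/(N(k+1)))·C(N−N'−1,k−1); and Q(N−1,k,j;H) = (1/(k+1))·C(N−j−1,k−1) if N'+1 ≤ j ≤ N−1. Moreover λ*_{j+1,j}(H) > 0 for j = 1,…,N'−1 and λ*_{N,j}(H) > 0 for j = N',…,N−1; in particular all H-certificates of H are nonnegative. -/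

import Mathlib

open Finset

/-- `Pinv H k m` is `P(k,m;H)`: the sum over all index sequences
`1 ≤ j(1) ≤ i(1) < j(2) ≤ i(2) < ⋯ < j(m) ≤ i(m) ≤ k` of `∏_{r} h_{i(r),j(r)}`,
with `P(k,0;H) = 1`. -/
noncomputable def Pinv (H : ℕ → ℕ → ℝ) (k : ℕ) : ℕ → ℝ
  | 0 => 1
  | m + 1 =>
    ∑ f : Fin (m + 1) → Fin (k + 1) × Fin (k + 1),
      if (∀ r, 1 ≤ ((f r).2 : ℕ) ∧ ((f r).2 : ℕ) ≤ ((f r).1 : ℕ)) ∧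
          (∀ r : Fin m, ((f r.castSucc).1 : ℕ) < ((f r.succ).2 : ℕ)) then
        ∏ r, H ((f r).1 : ℕ) ((f r).2 : ℕ)
      else 0

/-- `Qinv H k m j` is `Q(k,m,j;H)`: the partial sum of `P(k,m;H)` over those index
sequences with `j(1) = j` (zero if no such sequence exists, and zero for `m = 0`). -/
noncomputable def Qinv (H : ℕ → ℕ → ℝ) (k : ℕ) : ℕ → ℕ → ℝ
  | 0, _ => 0
  | m + 1, j =>
    ∑ f : Fin (m + 1) → Fin (k + 1) × Fin (k + 1),
      if (∀ r, 1 ≤ ((f r).2 : ℕ) ∧ ((f r).2 : ℕ) ≤ ((f r).1 : ℕ)) ∧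
          (∀ r : Fin m, ((f r.castSucc).1 : ℕ) < ((f r.succ).2 : ℕ)) ∧
          ((f 0).2 : ℕ) = j then
        ∏ r, H ((f r).1 : ℕ) ((f r).2 : ℕ)
      else 0

/-- The H-certificates `λ*_{k,j}(H)`:
`λ*_{N,j}(H) = N·Σ_{m=1}^{N−j} (−1)^{m−1}·Q(N−1,m,j;H)` for `j = 1,…,N−1`, and
`λ*_{k,j}(H) = N·Σ_{ℓ=1}^{N−j} Σ_{m=1}^{N−k} (−1)^{ℓ+m−1}·C(ℓ+m,m)·Q(N−1,ℓ,j;H)·Q(N−1,m,k;H)`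
for `1 ≤ j < k ≤ N−1`. -/
noncomputable def lamStar (N : ℕ) (H : ℕ → ℕ → ℝ) (k j : ℕ) : ℝ :=
  if k = N then
    (N : ℝ) * ∑ m ∈ Finset.Icc 1 (N - j), (-1 : ℝ) ^ (m - 1) * Qinv H (N - 1) m j
  else
    (N : ℝ) * ∑ l ∈ Finset.Icc 1 (N - j), ∑ m ∈ Finset.Icc 1 (N - k),
      (-1 : ℝ) ^ (l + m - 1) * (Nat.choose (l + m) m : ℝ) *
        Qinv H (N - 1) l j * Qinv H (N - 1) m k

theorem sum_Icc_one_eq_sum_range (f : ℕ → ℝ) (n : ℕ) :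
    ∑ l ∈ Icc 1 n, f l = ∑ i ∈ range n, f (i + 1) := by
  induction n with
  | zero => simp
  | succ n ih => rw [sum_Icc_succ_top (by omega), sum_range_succ, ih]

theorem sum_alternating_choose_mul_eq_fwdDiff (d : ℕ) (p : Polynomial ℝ) :
    ∑ i ∈ range (d + 1), (-1 : ℝ) ^ i * d.choose i * p.eval (i : ℝ) =
      (-1) ^ d * (fwdDiff (1 : ℝ))^[d] p.eval 0 := by
  rw [fwdDiff_iter_eq_sum_shift, mul_sum]
  refine sum_congr rfl fun i hi => ?_
  have hi' : i ≤ d := Nat.lt_succ_iff.mp (mem_range.mp hi)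
  obtain ⟨e, rfl⟩ := Nat.exists_eq_add_of_le hi'
  have h : ((-1 : ℝ) ^ e) * (-1) ^ e = 1 := by rw [← mul_pow]; simp
  simp only [Nat.add_sub_cancel_left, zsmul_eq_mul, nsmul_eq_mul, mul_one, zero_add]
  push_cast
  rw [pow_add]
  linear_combination (-(-1 : ℝ) ^ i * ((i + e).choose i : ℝ) * p.eval (i : ℝ)) * h

theorem sum_alternating_choose_mul_eval_of_natDegree_lt {d : ℕ} {p : Polynomial ℝ}
    (hp : p.natDegree < d) :
    ∑ i ∈ range (d + 1), (-1 : ℝ) ^ i * d.choose i * p.eval (i : ℝ) = 0 := by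
  rw [sum_alternating_choose_mul_eq_fwdDiff, Polynomial.fwdDiff_iter_eq_zero_of_degree_lt hp]
  simp

theorem sum_alternating_choose_mul_eval_of_monic {d : ℕ} {p : Polynomial ℝ}
    (hp : p.natDegree = d) (hm : p.Monic) :
    ∑ i ∈ range (d + 1), (-1 : ℝ) ^ i * d.choose i * p.eval (i : ℝ) = (-1) ^ d * d.factorial := by
  subst hp
  rw [sum_alternating_choose_mul_eq_fwdDiff, Polynomial.fwdDiff_iter_degree_eq_factorial]
  simp [hm.leadingCoeff]

theorem sum_alternating_choose_div_add_pos (d a : ℕ) :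
    0 < ∑ i ∈ range (d + 1), (-1 : ℝ) ^ i * d.choose i / ((i : ℝ) + a + 1) := by
  suffices h : ∑ i ∈ range (d + 1), (-1 : ℝ) ^ i * d.choose i / ((i : ℝ) + a + 1) =
      d.factorial * a.factorial / (a + d + 1).factorial by
    rw [h]; positivity
  induction d generalizing a with
  | zero =>
    simp [Nat.factorial_succ]; field_simp
  | succ d ih =>
    have key : ∑ i ∈ range (d + 1 + 1), (-1 : ℝ) ^ i * (d + 1).choose i / ((i : ℝ) + a + 1) =
        ∑ i ∈ range (d + 1), (-1 : ℝ) ^ i * d.choose i / ((i : ℝ) + a + 1) -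
        ∑ i ∈ range (d + 1), (-1 : ℝ) ^ i * d.choose i / ((i : ℝ) + (a + 1 : ℕ) + 1) := by
      rw [sum_range_succ']
      have h1 : ∑ i ∈ range (d + 1), (-1 : ℝ) ^ i * d.choose i / ((i : ℝ) + a + 1) =
          ∑ i ∈ range (d + 1), (-1 : ℝ) ^ (i + 1) * d.choose (i + 1) / (((i + 1 : ℕ) : ℝ) + a + 1)
            + 1 / ((a : ℝ) + 1) := by
        have := sum_range_succ' (fun i : ℕ => (-1 : ℝ) ^ i * d.choose i / ((i : ℝ) + a + 1)) (d + 1)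
        rw [sum_range_succ] at this
        simpa using this
      rw [h1, add_sub_right_comm, ← sum_sub_distrib]
      congr 1
      · refine sum_congr rfl fun i _ => ?_
        rw [Nat.choose_succ_succ]
        push_cast
        rw [pow_succ, show (i : ℝ) + (a + 1) + 1 = i + 1 + a + 1 by ring]
        ring
      · simp
    rw [key, ih, ih, show a + (d + 1) + 1 = a + d + 1 + 1 by ring,
      show a + 1 + d + 1 = a + d + 1 + 1 by ring, Nat.factorial_succ (a + d + 1),
      Nat.factorial_succ a, Nat.factorial_succ d]
    push_cast
    field_simp
    ring

theorem sum_mul_eval_eq_zero_of_degree_lt {d : ℕ} {s : Finset ℕ} {w : ℕ → ℝ}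
    {P : ℕ → Polynomial ℝ} (hdeg : ∀ m < d, (P m).natDegree = m) (hmonic : ∀ m < d, (P m).Monic)
    (h : ∀ m < d, ∑ i ∈ s, w i * (P m).eval (i : ℝ) = 0) (n : ℕ) (hn : n ≤ d)
    (p : Polynomial ℝ) (hp : p.degree < n) :
    ∑ i ∈ s, w i * p.eval (i : ℝ) = 0 := by
  induction n generalizing p with
  | zero =>
    have : p = 0 := by simpa using hp
    simp [this]
  | succ n ih =>
    have hlt : n < d := hn
    have h1 := ih (by omega) (p - Polynomial.C (p.coeff n) * P n) (by
      rw [Polynomial.degree_lt_iff_coeff_zero] at hp ⊢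
      intro k hk
      rcases hk.eq_or_lt with rfl | hk
      · have := (hmonic n hlt).coeff_natDegree
        rw [hdeg n hlt] at this
        simp [this]
      · rw [Polynomial.coeff_sub, Polynomial.coeff_C_mul, hp k hk,
          Polynomial.coeff_eq_zero_of_natDegree_lt ((hdeg n hlt).trans_lt hk)]
        simp)
    have h2 := h n hlt
    simp only [Polynomial.eval_sub, Polynomial.eval_mul, Polynomial.eval_C, mul_sub,
      sum_sub_distrib, mul_left_comm _ (p.coeff n), ← mul_sum, h2, mul_zero, sub_zero] at h1
    exact h1

theorem eq_mul_choose_of_sum_mul_eval_eq_zero {d : ℕ} {g : ℕ → ℝ}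
    {P : ℕ → Polynomial ℝ} (hdeg : ∀ m < d, (P m).natDegree = m) (hmonic : ∀ m < d, (P m).Monic)
    (h : ∀ m < d, ∑ i ∈ range (d + 1), (-1 : ℝ) ^ i * g i * (P m).eval (i : ℝ) = 0)
    (i : ℕ) (hi : i ≤ d) : g i = g 0 * d.choose i := by
  rcases Nat.eq_zero_or_pos i with rfl | hpos
  · simp
  have key : ∑ k ∈ range (d + 1), ((-1 : ℝ) ^ k * (g k - g 0 * d.choose k)) *
      (∏ t ∈ (Ioc 0 d).erase i, (Polynomial.X - Polynomial.C (t : ℝ))).eval (k : ℝ) = 0 := by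
    refine sum_mul_eval_eq_zero_of_degree_lt hdeg hmonic (fun m hm => ?_) d le_rfl _ ?_
    · have h1 := sum_alternating_choose_mul_eval_of_natDegree_lt ((hdeg m hm).trans_lt hm)
      calc _ = ∑ i ∈ range (d + 1), (-1 : ℝ) ^ i * g i * (P m).eval (i : ℝ) -
          g 0 * ∑ i ∈ range (d + 1), (-1 : ℝ) ^ i * d.choose i * (P m).eval (i : ℝ) := by
            rw [mul_sum, ← sum_sub_distrib]
            exact sum_congr rfl fun _ _ => by ring
        _ = 0 := by rw [h m hm, h1]; simp
    · rw [Polynomial.degree_prod]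
      simp only [Polynomial.degree_X_sub_C, sum_const, nsmul_eq_mul, mul_one]
      rw [card_erase_of_mem (by simp; omega)]
      simp only [Nat.card_Ioc]
      exact_mod_cast (by omega : d - 0 - 1 < d)
  rw [sum_eq_single i] at key
  · rcases mul_eq_zero.mp key with h1 | h1
    · rcases mul_eq_zero.mp h1 with h2 | h2
      · simp at h2
      · linarith
    · rw [Polynomial.eval_prod, prod_eq_zero_iff] at h1
      obtain ⟨t, ht, h2⟩ := h1
      simp only [Polynomial.eval_sub, Polynomial.eval_X, Polynomial.eval_C, sub_eq_zero] at h2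
      exact absurd (by exact_mod_cast h2.symm) (mem_erase.mp ht).1
  · intro k hk hki
    rcases Nat.eq_zero_or_pos k with rfl | hk0
    · simp
    · rw [Polynomial.eval_prod, prod_eq_zero (i := k)]
      · simp
      · simp only [mem_erase, mem_Ioc]
        exact ⟨hki, hk0, Nat.lt_succ_iff.mp (mem_range.mp hk)⟩
      · simp
  · intro h; simp at h; omega

theorem eq_zero_of_triangular {d : ℕ} {A : ℕ → ℝ} {b : ℕ → ℕ → ℝ}
    (hb : ∀ s, 1 ≤ s → s < d → b s s ≠ 0)
    (h : ∀ s, 1 ≤ s → s < d → ∑ m ∈ Icc 1 s, b s m * A m = 0) (s : ℕ) (hs : 1 ≤ s)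
    (hsd : s < d) : A s = 0 := by
  induction s using Nat.strong_induction_on with
  | _ s ih =>
    have h1 := h s hs hsd
    rw [sum_eq_single s] at h1
    · exact (mul_eq_zero.mp h1).resolve_left (hb s hs hsd)
    · intro m hm hms
      simp only [mem_Icc] at hm
      rw [ih m (by omega) hm.1 (by omega), mul_zero]
    · intro h; simp at h; omega

/-- The rising factorial `(X + a)(X + a + 1)⋯(X + a + m - 1)`. -/
noncomputable def risingPoly (a m : ℕ) : Polynomial ℝ :=
  (ascPochhammer ℝ m).comp (Polynomial.X + Polynomial.C (a : ℝ))

theorem risingPoly_natDegree (a m : ℕ) : (risingPoly a m).natDegree = m := by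
  rw [risingPoly, Polynomial.natDegree_comp, Polynomial.natDegree_X_add_C, ascPochhammer_natDegree,
    mul_one]

theorem risingPoly_monic (a m : ℕ) : (risingPoly a m).Monic :=
  (monic_ascPochhammer ℝ m).comp_X_add_C _

theorem risingPoly_eval (a m i : ℕ) :
    (risingPoly a m).eval (i : ℝ) = (i + a).ascFactorial m := by
  rw [risingPoly, ← ascPochhammer_nat_eq_natCast_ascFactorial]
  simp

theorem risingPoly_two_eval (m i : ℕ) :
    (risingPoly 2 m).eval (i : ℝ) = m.factorial * (i + 1 + m).choose m := by
  rw [risingPoly_eval, show i + 2 = i + 1 + 1 by ring, Nat.ascFactorial_eq_factorial_mul_choose]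
  push_cast; ring

theorem add_two_mul_risingPoly_three_eval (m i : ℕ) :
    ((i : ℝ) + 2) * (risingPoly 3 m).eval (i : ℝ) =
      (m + 1).factorial * (i + 1 + (m + 1)).choose (m + 1) := by
  have h := Nat.ascFactorial_eq_factorial_mul_choose (i + 1) (m + 1)
  have h2 : (i + 1 + 1).ascFactorial (m + 1) = (i + 2) * (i + 3).ascFactorial m := by
    rw [Nat.ascFactorial_succ, ← Nat.succ_ascFactorial]
  rw [risingPoly_eval]
  rw [h2] at h
  exact_mod_cast h

theorem add_val_le_of_increasing {n m : ℕ} {f : Fin (m + 1) → Fin (n + 1) × Fin (n + 1)}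
    (h1 : ∀ r, 1 ≤ ((f r).2 : ℕ) ∧ ((f r).2 : ℕ) ≤ ((f r).1 : ℕ))
    (h2 : ∀ r : Fin m, ((f r.castSucc).1 : ℕ) < ((f r.succ).2 : ℕ)) (r : Fin (m + 1)) :
    ((f 0).2 : ℕ) + r ≤ (f r).2 := by
  induction r using Fin.induction with
  | zero => simp
  | succ r ih =>
    have h3 := (h1 r.castSucc).2
    have h4 := h2 r
    simp only [Fin.val_castSucc, Fin.val_succ] at *
    omega

theorem add_le_of_increasing {n m : ℕ} {f : Fin (m + 1) → Fin (n + 1) × Fin (n + 1)}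
    (h1 : ∀ r, 1 ≤ ((f r).2 : ℕ) ∧ ((f r).2 : ℕ) ≤ ((f r).1 : ℕ))
    (h2 : ∀ r : Fin m, ((f r.castSucc).1 : ℕ) < ((f r.succ).2 : ℕ)) (r : Fin (m + 1)) :
    ((f r).1 : ℕ) + m ≤ n + r := by
  induction r using Fin.reverseInduction with
  | last =>
    have := (f (Fin.last m)).1.isLt
    simp only [Fin.val_last]
    omega
  | cast r ih =>
    have h3 := (h1 r.succ).2
    have h4 := h2 r
    simp only [Fin.val_castSucc, Fin.val_succ] at *
    omega

theorem Qinv_eq_zero (H : ℕ → ℕ → ℝ) {n m j : ℕ} (h : n + 1 < j + m) :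
    Qinv H n m j = 0 := by
  cases m with
  | zero => rfl
  | succ m =>
    rw [Qinv]
    refine sum_eq_zero fun f _ => if_neg ?_
    rintro ⟨h1, h2, h3⟩
    have := add_val_le_of_increasing h1 h2 (Fin.last m)
    have := (f (Fin.last m)).2.isLt
    simp only [Fin.val_last] at *
    omega

theorem Pinv_eq_sum_Qinv (H : ℕ → ℕ → ℝ) (n : ℕ) {m : ℕ} (hm : 1 ≤ m) :
    Pinv H n m = ∑ j ∈ Icc 1 n, Qinv H n m j := by
  obtain ⟨m, rfl⟩ := Nat.exists_eq_add_of_le' hm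
  simp only [Pinv, Qinv]
  rw [sum_comm]
  refine sum_congr rfl fun f _ => ?_
  split_ifs with h
  · rw [sum_eq_single ((f 0).2 : ℕ)]
    · rw [if_pos ⟨h.1, h.2, rfl⟩]
    · intro j _ hj
      exact if_neg fun h' => hj h'.2.2.symm
    · intro h'
      exact absurd (mem_Icc.mpr ⟨(h.1 0).1, Nat.lt_succ_iff.mp (f 0).2.isLt⟩) h'
  · exact (sum_eq_zero fun j _ => if_neg fun h' => h ⟨h'.1, h'.2.1⟩).symm

theorem Qinv_eq_prod_diag (H : ℕ → ℕ → ℝ) {n m j : ℕ} (hj : 1 ≤ j) (hm : 1 ≤ m)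
    (h : j + m = n + 1) : Qinv H n m j = ∏ r ∈ range m, H (j + r) (j + r) := by
  obtain ⟨m, rfl⟩ := Nat.exists_eq_add_of_le' hm
  have hlt : ∀ r : Fin (m + 1), j + (r : ℕ) < n + 1 := fun r => by omega
  rw [Qinv, sum_eq_single fun r => (⟨j + r, hlt r⟩, ⟨j + r, hlt r⟩)]
  · rw [if_pos, prod_range]
    refine ⟨fun r => ⟨by simp only; omega, le_rfl⟩, fun r => ?_, by simp⟩
    simp only [Fin.val_castSucc, Fin.val_succ]
    omega
  · intro f _ hf
    refine if_neg ?_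
    rintro ⟨h1, h2, h3⟩
    apply hf
    have hlow := add_val_le_of_increasing h1 h2
    have hup := add_le_of_increasing h1 h2
    funext r
    have h4 := hlow r
    have h5 := hup r
    have h6 := (h1 r).2
    ext <;> simp only <;> omega
  · simp

theorem Qinv_diag_ne_zero {H : ℕ → ℕ → ℝ} {n : ℕ} (h : Pinv H n n ≠ 0) {j : ℕ} (hj : 1 ≤ j)
    (hjn : j ≤ n) : Qinv H n (n + 1 - j) j ≠ 0 := by
  rw [Pinv_eq_sum_Qinv H n (hj.trans hjn), sum_eq_single 1 (fun k hk hk1 =>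
      Qinv_eq_zero H (by have := mem_Icc.mp hk; omega)) (by simp; omega),
    Qinv_eq_prod_diag H le_rfl (hj.trans hjn) (by omega), prod_ne_zero_iff] at h
  rw [Qinv_eq_prod_diag H hj (by omega) (by omega), prod_ne_zero_iff]
  intro r hr
  have hr' := mem_range.mp hr
  have := h (j - 1 + r) (mem_range.mpr (by omega))
  rwa [show 1 + (j - 1 + r) = j + r by omega] at this

/-- The alternating binomial moment of `q` over `1, …, d + 1` occurring in the H-certificates. -/
noncomputable def signedMoment (q : ℕ → ℝ) (d m : ℕ) : ℝ :=
  ∑ i ∈ range (d + 1), (-1 : ℝ) ^ i * q (i + 1) * ((i + 1 + m).choose m : ℝ)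

theorem lamStar_self (N : ℕ) (H : ℕ → ℕ → ℝ) {j : ℕ} (hj : j < N) :
    lamStar N H N j = N * signedMoment (fun l => Qinv H (N - 1) l j) (N - j - 1) 0 := by
  rw [lamStar, if_pos rfl, sum_Icc_one_eq_sum_range, signedMoment,
    show N - j - 1 + 1 = N - j by omega]
  simp

theorem lamStar_of_ne (N : ℕ) (H : ℕ → ℕ → ℝ) {k j : ℕ} (hk : k ≠ N) (hj : j < N) :
    lamStar N H k j = N * ∑ m ∈ Icc 1 (N - k), ((-1) ^ m * Qinv H (N - 1) m k) *
      signedMoment (fun l => Qinv H (N - 1) l j) (N - j - 1) m := by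
  rw [lamStar, if_neg hk, sum_comm]
  congr 1
  refine sum_congr rfl fun m _ => ?_
  rw [sum_Icc_one_eq_sum_range, signedMoment, show N - j - 1 + 1 = N - j by omega, mul_sum]
  refine sum_congr rfl fun i _ => ?_
  rw [show i + 1 + m - 1 = i + m by omega, pow_add]
  ring

theorem eq_mul_choose_of_signedMoment_eq_zero {q : ℕ → ℝ} {d : ℕ}
    (h : ∀ m < d, signedMoment q d m = 0) (i : ℕ) (hi : i ≤ d) :
    q (i + 1) = q 1 * d.choose i := by
  refine eq_mul_choose_of_sum_mul_eval_eq_zero (g := fun i => q (i + 1)) (P := risingPoly 2)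
    (fun m _ => risingPoly_natDegree 2 m) (fun m _ => risingPoly_monic 2 m) (fun m hm => ?_) i hi
  have := congrArg ((m.factorial : ℝ) * ·) (h m hm)
  simp only [signedMoment, mul_sum, mul_zero] at this
  rw [← this]
  refine sum_congr rfl fun i _ => ?_
  rw [risingPoly_two_eval]
  ring

theorem add_two_mul_eq_of_signedMoment_eq_zero {q : ℕ → ℝ} {d : ℕ}
    (h : ∀ m, 1 ≤ m → m ≤ d → signedMoment q d m = 0) (i : ℕ) (hi : i ≤ d) :
    ((i : ℝ) + 2) * q (i + 1) = 2 * q 1 * d.choose i := by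
  have key := eq_mul_choose_of_sum_mul_eval_eq_zero (d := d)
    (g := fun i : ℕ => ((i : ℝ) + 2) * q (i + 1))
    (P := risingPoly 3) (fun m _ => risingPoly_natDegree 3 m) (fun m _ => risingPoly_monic 3 m)
    (fun m hm => ?_) i hi
  · simpa using key
  have := congrArg (((m + 1).factorial : ℝ) * ·) (h (m + 1) (by omega) hm)
  simp only [signedMoment, mul_sum, mul_zero] at this
  rw [← this]
  refine sum_congr rfl fun i _ => ?_
  linear_combination ((-1) ^ i * q (i + 1)) * add_two_mul_risingPoly_three_eval m i

theorem signedMoment_mul_choose (c : ℝ) (q : ℕ → ℝ) {d m : ℕ} (hm : m ≤ d)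
    (hq : ∀ i ≤ d, q (i + 1) = c * d.choose i) :
    signedMoment q d m = if m = d then c * (-1) ^ d else 0 := by
  have h0 : (m.factorial : ℝ) ≠ 0 := by positivity
  have key : m.factorial * signedMoment q d m =
      c * ∑ i ∈ range (d + 1), (-1 : ℝ) ^ i * d.choose i * (risingPoly 2 m).eval (i : ℝ) := by
    rw [signedMoment, mul_sum, mul_sum]
    refine sum_congr rfl fun i hi => ?_
    rw [hq i (Nat.lt_succ_iff.mp (mem_range.mp hi)), risingPoly_two_eval]
    ring
  apply mul_left_cancel₀ h0
  rw [key]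
  split_ifs with h
  · subst h
    rw [sum_alternating_choose_mul_eval_of_monic (risingPoly_natDegree 2 m) (risingPoly_monic 2 m)]
    ring
  · rw [sum_alternating_choose_mul_eval_of_natDegree_lt]
    · simp
    · rw [risingPoly_natDegree]; omega

theorem signedMoment_zero_pos {c : ℝ} (hc : 0 < c) {q : ℕ → ℝ} {d : ℕ}
    (hq : ∀ i ≤ d, q (i + 1) = c * (d.choose i / ((i : ℝ) + 2))) :
    0 < signedMoment q d 0 := by
  have : signedMoment q d 0 =
      c * ∑ i ∈ range (d + 1), (-1 : ℝ) ^ i * d.choose i / ((i : ℝ) + (1 : ℕ) + 1) := by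
    rw [signedMoment, mul_sum]
    refine sum_congr rfl fun i hi => ?_
    rw [hq i (Nat.lt_succ_iff.mp (mem_range.mp hi)), Nat.choose_zero_right,
      show (i : ℝ) + (1 : ℕ) + 1 = i + 2 by push_cast; ring]
    push_cast; ring
  rw [this]
  exact mul_pos hc (sum_alternating_choose_div_add_pos d 1)

/-- The Q-values of the mixed sparsity family. -/
noncomputable def mixedQ (N N' j k : ℕ) : ℝ :=
  (if j < N' then (j : ℝ) / N
    else if j = N' then (N' : ℝ) * (N - N' + 1) / (N * (k + 1))
    else 1 / ((k : ℝ) + 1)) * (N - j - 1).choose (k - 1)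

theorem mixedQ_pos {N N' j k : ℕ} (hN' : 1 ≤ N') (hN'N : N' < N) (hj : 1 ≤ j) (hk : k ≤ N - j)
    (hk1 : 1 ≤ k) : 0 < mixedQ N N' j k := by
  have h1 : 0 < (N - j - 1).choose (k - 1) := Nat.choose_pos (by omega)
  have h2 : (N' : ℝ) < N := by exact_mod_cast hN'N
  have h3 : (0 : ℝ) < N' := by exact_mod_cast hN'
  have h4 : (0 : ℝ) < N := h3.trans h2
  have h5 : (0 : ℝ) < j := by exact_mod_cast hj
  have h6 : (0 : ℝ) < (N : ℝ) - N' + 1 := by linarith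
  unfold mixedQ
  apply mul_pos _ (by exact_mod_cast h1)
  split_ifs <;> positivity

theorem mixedQ_eq_zero {N N' j k : ℕ} (hj : j < N) (hk : N < j + k) : mixedQ N N' j k = 0 := by
  rw [mixedQ, Nat.choose_eq_zero_of_lt (by omega)]
  simp

theorem sum_mixedQ_aux (p a b : ℕ) :
    ∑ i ∈ range a, ((i : ℝ) + 1) / (a + b + 2) * ((a + b - i).choose p : ℝ) +
      (((a : ℝ) + 1) * (b + 2) / ((a + b + 2) * (p + 2)) * (b.choose p : ℝ) +
        1 / ((p : ℝ) + 2) * (b.choose (p + 1) : ℝ)) =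
      1 / ((a : ℝ) + b + 2) * ((a + b + 2).choose (p + 2) : ℝ) := by
  induction a generalizing b with
  | zero =>
    have h := Nat.add_one_mul_choose_eq (b + 1) (p + 1)
    rw [Nat.choose_succ_succ b p] at h
    have h' : ((b : ℝ) + 1 + 1) * (b.choose p + b.choose (p + 1)) =
      ((b + 2).choose (p + 2) : ℝ) * (p + 1 + 1) := by exact_mod_cast h
    simp only [range_zero, sum_empty, zero_add, Nat.cast_zero]
    field_simp
    linear_combination h'
  | succ a ih =>
    have h1 := ih (b + 1)
    rw [sum_range_succ]
    have e1 : ∀ i, a + 1 + b - i = a + (b + 1) - i := fun i => by omega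
    have e2 : a + (b + 1) - a = b + 1 := by omega
    have e3 : a + 1 + b + 2 = a + (b + 1) + 2 := by omega
    simp only [e1, e2, e3]
    push_cast at h1 ⊢
    have e4 : (a : ℝ) + 1 + b + 2 = a + (b + 1) + 2 := by ring
    rw [e4, ← h1]
    rw [add_assoc]
    congr 1
    rw [Nat.choose_succ_succ b p]
    cases p with
    | zero =>
      simp
      field_simp
      ring
    | succ p =>
      have e6 : ((b.choose (p + 1) : ℝ)) * (p + 1) = (b.choose p) * (b - p) := by
        rcases le_or_gt p b with h | h
        · have := Nat.choose_succ_right_eq b p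
          rw [← Nat.cast_sub h]
          exact_mod_cast this
        · simp [Nat.choose_eq_zero_of_lt h, Nat.choose_eq_zero_of_lt (h.trans (Nat.lt_succ_self p))]
      rw [Nat.choose_succ_succ b p]
      push_cast
      field_simp
      linear_combination ((a : ℝ) + 1) * e6

theorem sum_range_choose_const (p b : ℕ) :
    ∑ i ∈ range b, ((b - 1 - i).choose p : ℝ) = (b.choose (p + 1) : ℝ) := by
  rw [sum_range_reflect (fun i => (i.choose p : ℝ))]
  induction b with
  | zero => simp
  | succ b ih => rw [sum_range_succ, ih, Nat.choose_succ_succ]; push_cast; ring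

theorem sum_mixedQ {N N' m : ℕ} (hN' : 1 ≤ N') (hN'N : N' < N) (hm : 1 ≤ m) :
    ∑ j ∈ Icc 1 (N - 1), mixedQ N N' j m = 1 / (N : ℝ) * (N.choose (m + 1) : ℝ) := by
  obtain ⟨a, rfl⟩ := Nat.exists_eq_add_of_le' hN'
  obtain ⟨b, rfl⟩ := Nat.exists_eq_add_of_le hN'N
  obtain ⟨p, rfl⟩ := Nat.exists_eq_add_of_le' hm
  have hk := sum_mixedQ_aux p a b
  have e : a + 1 + 1 + b - 1 = a + (b + 1) := by omega
  rw [sum_Icc_one_eq_sum_range, e, sum_range_add, sum_range_succ']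
  rw [← sum_range_choose_const, mul_sum] at hk
  have e1 : ((a + 1 + 1 + b : ℕ) : ℝ) = a + b + 2 := by push_cast; ring
  have e2 : a + 1 + 1 + b = a + b + 2 := by omega
  rw [e1, show (a + 1 + 1 + b).choose (p + 1 + 1) = (a + b + 2).choose (p + 2) by rw [e2], ← hk]
  congr 1
  · refine sum_congr rfl fun i hi => ?_
    have := mem_range.mp hi
    rw [mixedQ, if_pos (by omega), e1, show a + 1 + 1 + b - (i + 1) - 1 = a + b - i by omega]
    push_cast
    simp
  · rw [add_comm]
    congr 1
    · rw [mixedQ, if_neg (by omega), if_pos (by omega), e1,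
        show a + 1 + 1 + b - (a + 0 + 1) - 1 = b by omega]
      push_cast
      rw [show (a : ℝ) + b + 2 - (a + 1) + 1 = b + 2 by ring,
        show (p : ℝ) + 1 + 1 = p + 2 by ring]
    · refine sum_congr rfl fun i hi => ?_
      have := mem_range.mp hi
      rw [mixedQ, if_neg (by omega), if_neg (by omega),
        show a + 1 + 1 + b - (a + (i + 1) + 1) - 1 = b - 1 - i by omega]
      push_cast
      rw [show (p : ℝ) + 1 + 1 = p + 2 by ring]

theorem Qinv_eq_mul_mixedQ {N N' : ℕ} (hN'1 : 1 ≤ N') (hN'2 : N' < N) {H : ℕ → ℕ → ℝ}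
    (hdiag : ∀ k, 1 ≤ k → k < N → Qinv H (N - 1) (N - k) k ≠ 0)
    (hsparse1 : ∀ j k, 1 ≤ j → j ≤ N' - 1 → j + 2 ≤ k → k ≤ N → lamStar N H k j = 0)
    (hsparse2 : ∀ j k, N' ≤ j → j ≤ N - 2 → j + 1 ≤ k → k ≤ N - 1 → lamStar N H k j = 0)
    {j : ℕ} (hj1 : 1 ≤ j) (hjN : j < N) :
    ∃ c : ℝ, ∀ m, 1 ≤ m → Qinv H (N - 1) m j = c * mixedQ N N' j m := by
  have hN0 : (N : ℝ) ≠ 0 := by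
    have : N ≠ 0 := by omega
    exact_mod_cast this
  have hb : ∀ d, ∀ s, 1 ≤ s → s < d → d ≤ N →
      (-1 : ℝ) ^ s * Qinv H (N - 1) s (N - s) ≠ 0 := by
    intro d s hs hsd hd
    have := hdiag (N - s) (by omega) (by omega)
    rw [show N - (N - s) = s by omega] at this
    exact mul_ne_zero (by simp) this
  have extend : ∀ c : ℝ, (∀ i ≤ N - j - 1, Qinv H (N - 1) (i + 1) j = c * mixedQ N N' j (i + 1)) →
      ∀ m, 1 ≤ m → Qinv H (N - 1) m j = c * mixedQ N N' j m := by
    intro c hc m hm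
    obtain ⟨i, rfl⟩ := Nat.exists_eq_add_of_le' hm
    rcases le_or_gt i (N - j - 1) with hi | hi
    · exact hc i hi
    · rw [Qinv_eq_zero H (by omega), mixedQ_eq_zero hjN (by omega), mul_zero]
  rcases lt_or_ge j N' with hlt | hge
  · have hmom : ∀ m < N - j - 1,
        signedMoment (fun l => Qinv H (N - 1) l j) (N - j - 1) m = 0 := by
      intro m hm
      rcases Nat.eq_zero_or_pos m with rfl | hpos
      · have h0 := hsparse1 j N hj1 (by omega) (by omega) le_rfl
        rw [lamStar_self N H hjN] at h0
        exact (mul_eq_zero.mp h0).resolve_left hN0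
      · refine eq_zero_of_triangular
          (b := fun s m => (-1) ^ m * Qinv H (N - 1) m (N - s))
          (fun s hs hsd => hb _ s hs hsd (by omega)) (fun s hs hsd => ?_) m hpos hm
        have h0 := hsparse1 j (N - s) hj1 (by omega) (by omega) (by omega)
        rw [lamStar_of_ne N H (by omega) hjN, show N - (N - s) = s by omega] at h0
        exact (mul_eq_zero.mp h0).resolve_left hN0
    refine ⟨Qinv H (N - 1) 1 j * (N / j), extend _ fun i hi => ?_⟩
    have hj0 : (j : ℝ) ≠ 0 := by
      have : j ≠ 0 := by omega
      exact_mod_cast this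
    rw [eq_mul_choose_of_signedMoment_eq_zero (q := fun l => Qinv H (N - 1) l j) hmom i hi,
      mixedQ, if_pos hlt, Nat.add_sub_cancel]
    field_simp
  · have hmom : ∀ m, 1 ≤ m → m ≤ N - j - 1 →
        signedMoment (fun l => Qinv H (N - 1) l j) (N - j - 1) m = 0 := by
      intro m hm1 hm
      refine eq_zero_of_triangular
        (b := fun s m => (-1) ^ m * Qinv H (N - 1) m (N - s))
        (fun s hs hsd => hb (N - j) s hs hsd (by omega)) (fun s hs hsd => ?_) m hm1 (by omega)
      have h0 := hsparse2 j (N - s) hge (by omega) (by omega) (by omega)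
      rw [lamStar_of_ne N H (by omega) hjN, show N - (N - s) = s by omega] at h0
      exact (mul_eq_zero.mp h0).resolve_left hN0
    have hq := add_two_mul_eq_of_signedMoment_eq_zero (q := fun l => Qinv H (N - 1) l j) hmom
    rcases hge.eq_or_lt with rfl | hgt
    · have hp : ((N : ℝ) - N' + 1) ≠ 0 := by
        have : (N' : ℝ) < N := by exact_mod_cast hN'2
        linarith
      have hp' : (N' : ℝ) ≠ 0 := by
        have : N' ≠ 0 := by omega
        exact_mod_cast this
      refine ⟨Qinv H (N - 1) 1 N' * (2 * N / (N' * (N - N' + 1))), extend _ fun i hi => ?_⟩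
      rw [mixedQ, if_neg (lt_irrefl _), if_pos rfl, Nat.add_sub_cancel]
      have hi2 : (i : ℝ) + 2 ≠ 0 := by positivity
      apply mul_left_cancel₀ hi2
      rw [hq i hi]
      push_cast
      rw [show (i : ℝ) + 1 + 1 = i + 2 by ring]
      field_simp
    · refine ⟨Qinv H (N - 1) 1 j * 2, extend _ fun i hi => ?_⟩
      rw [mixedQ, if_neg (by omega), if_neg (by omega), Nat.add_sub_cancel]
      have hi2 : (i : ℝ) + 2 ≠ 0 := by positivity
      apply mul_left_cancel₀ hi2
      rw [hq i hi]
      push_cast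
      rw [show (i : ℝ) + 1 + 1 = i + 2 by ring]
      field_simp

theorem eq_one_of_sum_mul_mixedQ {N N' : ℕ} (hN'1 : 1 ≤ N') (hN'2 : N' < N) {c : ℕ → ℝ}
    (h : ∀ m, 1 ≤ m → m ≤ N - 1 →
      ∑ j ∈ Icc 1 (N - 1), c j * mixedQ N N' j m = ∑ j ∈ Icc 1 (N - 1), mixedQ N N' j m)
    (j : ℕ) (hj1 : 1 ≤ j) (hjN : j < N) : c j = 1 := by
  induction j using Nat.strong_induction_on with
  | _ j ih =>
    have h1 : ∑ i ∈ Icc 1 (N - 1), (c i - 1) * mixedQ N N' i (N - j) = 0 := by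
      simp only [sub_mul, one_mul, sum_sub_distrib]
      rw [h (N - j) (by omega) (by omega), sub_self]
    rw [sum_eq_single j] at h1
    · have h2 := (mul_eq_zero.mp h1).resolve_right
        (mixedQ_pos hN'1 hN'2 hj1 le_rfl (by omega)).ne'
      linarith
    · intro i hi hij
      have hi' := mem_Icc.mp hi
      rcases lt_or_gt_of_ne hij with hlt | hgt
      · rw [ih i hlt hi'.1 (by omega)]
        simp
      · rw [mixedQ_eq_zero (by omega) (by omega), mul_zero]
    · intro hj
      exact absurd (mem_Icc.mpr ⟨hj1, by omega⟩) hj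

theorem Qinv_eq_mixedQ {N N' : ℕ} (hN'1 : 1 ≤ N') (hN'2 : N' < N) {H : ℕ → ℕ → ℝ}
    (hinv : ∀ m, 1 ≤ m → m ≤ N - 1 →
      Pinv H (N - 1) m = 1 / (N : ℝ) * (Nat.choose N (m + 1) : ℝ))
    (hsparse1 : ∀ j k, 1 ≤ j → j ≤ N' - 1 → j + 2 ≤ k → k ≤ N → lamStar N H k j = 0)
    (hsparse2 : ∀ j k, N' ≤ j → j ≤ N - 2 → j + 1 ≤ k → k ≤ N - 1 → lamStar N H k j = 0)
    {j m : ℕ} (hj1 : 1 ≤ j) (hjN : j < N) (hm : 1 ≤ m) :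
    Qinv H (N - 1) m j = mixedQ N N' j m := by
  have hP : Pinv H (N - 1) (N - 1) ≠ 0 := by
    have : (N : ℝ) ≠ 0 := by
      have : N ≠ 0 := by omega
      exact_mod_cast this
    rw [hinv (N - 1) (by omega) le_rfl, show N - 1 + 1 = N by omega]
    simpa using this
  have hdiag : ∀ k, 1 ≤ k → k < N → Qinv H (N - 1) (N - k) k ≠ 0 := by
    intro k hk hkN
    have := Qinv_diag_ne_zero hP hk (by omega)
    rwa [show N - 1 + 1 - k = N - k by omega] at this
  choose! c hc using fun (j : ℕ) (hj : 1 ≤ j ∧ j < N) =>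
    Qinv_eq_mul_mixedQ hN'1 hN'2 hdiag hsparse1 hsparse2 hj.1 hj.2
  rw [hc j ⟨hj1, hjN⟩ m hm, eq_one_of_sum_mul_mixedQ hN'1 hN'2 (c := c) _ j hj1 hjN, one_mul]
  intro p hp hpN
  rw [sum_mixedQ hN'1 hN'2 hp, ← hinv p hp hpN, Pinv_eq_sum_Qinv H (N - 1) hp]
  refine sum_congr rfl fun i hi => ?_
  have hi' := mem_Icc.mp hi
  rw [hc i ⟨hi'.1, by omega⟩ p hp]

theorem lamStar_succ_pos {N N' : ℕ} (hN'2 : N' < N) {H : ℕ → ℕ → ℝ}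
    (hQ : ∀ j m, 1 ≤ j → j < N → 1 ≤ m → Qinv H (N - 1) m j = mixedQ N N' j m)
    {j : ℕ} (hj1 : 1 ≤ j) (hj : j < N') : 0 < lamStar N H (j + 1) j := by
  have hN : (0 : ℝ) < N := by exact_mod_cast (by omega : 0 < N)
  have hj0 : (0 : ℝ) < j := by exact_mod_cast hj1
  have hmom : ∀ m ≤ N - j - 1, signedMoment (fun l => Qinv H (N - 1) l j) (N - j - 1) m =
      if m = N - j - 1 then (j / N : ℝ) * (-1) ^ (N - j - 1) else 0 := fun m hm =>
    signedMoment_mul_choose _ _ hm fun i _ => by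
      rw [hQ j (i + 1) hj1 (by omega) (by omega), mixedQ, if_pos hj, Nat.add_sub_cancel]
  rw [lamStar_of_ne N H (by omega) (by omega)]
  refine mul_pos hN ?_
  rw [← Nat.sub_sub, sum_eq_single (N - j - 1)]
  · rw [hmom _ le_rfl, if_pos rfl, hQ (j + 1) _ (by omega) (by omega) (by omega)]
    have h1 := mixedQ_pos (N' := N') (by omega) hN'2 (show 1 ≤ j + 1 by omega)
      (show N - j - 1 ≤ N - (j + 1) by omega) (by omega)
    have h2 : ((-1 : ℝ) ^ (N - j - 1)) * (-1) ^ (N - j - 1) = 1 := by rw [← mul_pow]; simp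
    calc (0 : ℝ) < mixedQ N N' (j + 1) (N - j - 1) * (j / N) := by positivity
      _ = _ := by linear_combination (-mixedQ N N' (j + 1) (N - j - 1) * (j / N)) * h2
  · intro m hm hne
    rw [hmom m (mem_Icc.mp hm).2, if_neg hne, mul_zero]
  · intro h
    exact absurd (mem_Icc.mpr ⟨by omega, le_rfl⟩) h

theorem lamStar_self_pos {N N' : ℕ} (hN'1 : 1 ≤ N') (hN'2 : N' < N) {H : ℕ → ℕ → ℝ}
    (hQ : ∀ j m, 1 ≤ j → j < N → 1 ≤ m → Qinv H (N - 1) m j = mixedQ N N' j m)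
    {j : ℕ} (hj : N' ≤ j) (hjN : j < N) : 0 < lamStar N H N j := by
  have hN : (0 : ℝ) < N := by exact_mod_cast (by omega : 0 < N)
  rw [lamStar_self N H hjN]
  refine mul_pos hN ?_
  rcases hj.eq_or_lt with rfl | hgt
  · have h1 : (N' : ℝ) < N := by exact_mod_cast hN'2
    have h2 : (0 : ℝ) < N' := by exact_mod_cast hN'1
    have h3 : (0 : ℝ) < (N : ℝ) - N' + 1 := by linarith
    refine signedMoment_zero_pos (c := N' * (N - N' + 1) / N) (by positivity) fun i _ => ?_
    rw [hQ N' (i + 1) hN'1 hjN (by omega), mixedQ, if_neg (lt_irrefl _), if_pos rfl,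
      Nat.add_sub_cancel]
    push_cast
    rw [show (i : ℝ) + 1 + 1 = i + 2 by ring]
    field_simp
  · refine signedMoment_zero_pos one_pos fun i _ => ?_
    rw [hQ j (i + 1) (by omega) hjN (by omega), mixedQ, if_neg (by omega), if_neg (by omega),
      Nat.add_sub_cancel]
    push_cast
    rw [show (i : ℝ) + 1 + 1 = i + 2 by ring]
    field_simp

/-- **Mixed sparsity pattern: new optimal algorithms (Prop 8.6).**
Let `N ≥ 4` and `2 ≤ N' ≤ N−2`. If `H` satisfies H-invariance, the top-sparsity pattern
`λ*_{k,j}(H) = 0` for `j = 1,…,N'−1`, `k = j+2,…,N`, and the bottom-sparsity pattern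
`λ*_{k,j}(H) = 0` for `j = N',…,N−2`, `k = j+1,…,N−1`, then the Q-functions of `H` are as
in (19): `(j/N)·C(N−j−1,k−1)` for `j ≤ N'−1`, `(N'(N−N'+1)/(N(k+1)))·C(N−N'−1,k−1)` for
`j = N'`, and `(1/(k+1))·C(N−j−1,k−1)` for `j ≥ N'+1`. Moreover `λ*_{j+1,j}(H) > 0` for
`j = 1,…,N'−1` and `λ*_{N,j}(H) > 0` for `j = N',…,N−1`; in particular all H-certificates
of `H` are nonnegative. -/
theorem mixed_sparsity_family (N N' : ℕ) (hN : 4 ≤ N) (hN'1 : 2 ≤ N') (hN'2 : N' ≤ N - 2)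
    (H : ℕ → ℕ → ℝ)
    (hinv : ∀ m, 1 ≤ m → m ≤ N - 1 →
      Pinv H (N - 1) m = 1 / (N : ℝ) * (Nat.choose N (m + 1) : ℝ))
    (hsparse1 : ∀ j k, 1 ≤ j → j ≤ N' - 1 → j + 2 ≤ k → k ≤ N → lamStar N H k j = 0)
    (hsparse2 : ∀ j k, N' ≤ j → j ≤ N - 2 → j + 1 ≤ k → k ≤ N - 1 → lamStar N H k j = 0) :
    ((∀ j k, 1 ≤ j → j ≤ N' - 1 → 1 ≤ k → k ≤ N - j →
        Qinv H (N - 1) k j = (j : ℝ) / (N : ℝ) * (Nat.choose (N - j - 1) (k - 1) : ℝ)) ∧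
      (∀ k, 1 ≤ k → k ≤ N - N' →
        Qinv H (N - 1) k N'
          = ((N' : ℝ) * ((N : ℝ) - (N' : ℝ) + 1)) / ((N : ℝ) * ((k : ℝ) + 1))
            * (Nat.choose (N - N' - 1) (k - 1) : ℝ)) ∧
      (∀ j k, N' + 1 ≤ j → j ≤ N - 1 → 1 ≤ k → k ≤ N - j →
        Qinv H (N - 1) k j
          = 1 / ((k : ℝ) + 1) * (Nat.choose (N - j - 1) (k - 1) : ℝ))) ∧
    ((∀ j, 1 ≤ j → j ≤ N' - 1 → 0 < lamStar N H (j + 1) j) ∧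
      (∀ j, N' ≤ j → j ≤ N - 1 → 0 < lamStar N H N j) ∧
      (∀ k j, 1 ≤ j → j < k → k ≤ N → 0 ≤ lamStar N H k j)) := by
  have hQ : ∀ j m, 1 ≤ j → j < N → 1 ≤ m → Qinv H (N - 1) m j = mixedQ N N' j m :=
    fun j m hj hjN hm =>
      Qinv_eq_mixedQ (by omega) (by omega) hinv hsparse1 hsparse2 hj hjN hm
  have htop : ∀ j, 1 ≤ j → j ≤ N' - 1 → 0 < lamStar N H (j + 1) j := fun j hj1 hj =>
    lamStar_succ_pos (by omega) hQ hj1 (by omega)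
  have hbot : ∀ j, N' ≤ j → j ≤ N - 1 → 0 < lamStar N H N j := fun j hj hjN =>
    lamStar_self_pos (by omega) (by omega) hQ hj (by omega)
  refine ⟨⟨fun j k hj1 hj hk _ => ?_, fun k hk _ => ?_, fun j k hj hjN hk _ => ?_⟩,
    htop, hbot, fun k j hj hjk hkN => ?_⟩
  · rw [hQ j k hj1 (by omega) hk, mixedQ, if_pos (by omega)]
  · rw [hQ N' k (by omega) (by omega) hk, mixedQ, if_neg (lt_irrefl _), if_pos rfl]
  · rw [hQ j k (by omega) (by omega) hk, mixedQ, if_neg (by omega), if_neg (by omega)]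
  · rcases lt_or_ge j N' with hlt | hge
    · rcases (Nat.succ_le_of_lt hjk).eq_or_lt with h | h
      · subst h
        exact (htop j hj (by omega)).le
      · exact (hsparse1 j k hj (by omega) h hkN).ge
    · rcases hkN.eq_or_lt with h | h
      · subst h
        exact (hbot j hge (by omega)).le
      · exact (hsparse2 j k hge (by omega) hjk (by omega)).ge
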